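/- arXiv:2302.03422 — 2 statements merged into one kernel-verified Lean document; each statement's English description precedes it below -/
import Mathlib

section
/- Let n ≥ 1 and let A be an invertible continuous linear automorphism of ℂⁿ with operator norm ‖A‖ < 1. Then the ℤ-action on ℂⁿ \ {0} defined by k • x = Aᵏ(x) is properly discontinuous: for any compact subsets K, L of ℂⁿ \ {0}, the set of integers k with Aᵏ(K) ∩ L ≠ ∅ is finite. -/
theorem norm_pow_apply_le {𝕜 E : Type*} [NontriviallyNormedField 𝕜]
    [NormedAddCommGroup E] [NormedSpace 𝕜 E] (A : E ≃L[𝕜] E) (m : ℕ) (x : E) :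
    ‖(A ^ m) x‖ ≤ ‖(A : E →L[𝕜] E)‖ ^ m * ‖x‖ := by
  induction m with
  | zero =>
    rw [pow_zero, pow_zero, one_mul]
    exact le_refl ‖x‖
  | succ m ih =>
    calc ‖(A ^ (m + 1)) x‖ = ‖(A : E →L[𝕜] E) ((A ^ m) x)‖ := by rw [pow_succ']; rfl
      _ ≤ ‖(A : E →L[𝕜] E)‖ * ‖(A ^ m) x‖ := (A : E →L[𝕜] E).le_opNorm _
      _ ≤ ‖(A : E →L[𝕜] E)‖ * (‖(A : E →L[𝕜] E)‖ ^ m * ‖x‖) := by gcongr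
      _ = ‖(A : E →L[𝕜] E)‖ ^ (m + 1) * ‖x‖ := by ring

open Filter Topology in
/-- Large iterates of a linear contraction move a bounded set off any closed set avoiding `0`. -/
theorem exists_forall_pow_apply_mem_lt {𝕜 E : Type*} [NontriviallyNormedField 𝕜]
    [NormedAddCommGroup E] [NormedSpace 𝕜 E] (A : E ≃L[𝕜] E) (hA : ‖(A : E →L[𝕜] E)‖ < 1)
    {K L : Set E} (hK : Bornology.IsBounded K) (hL : IsClosed L) (hL0 : (0 : E) ∉ L) :
    ∃ N : ℕ, ∀ m : ℕ, ∀ x ∈ K, (A ^ m) x ∈ L → m < N := by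
  obtain ⟨R, hR⟩ := hK.exists_norm_le
  obtain ⟨ε, hε, hball⟩ := Metric.isOpen_iff.1 hL.isOpen_compl 0 hL0
  have hlim : Tendsto (fun m : ℕ => ‖(A : E →L[𝕜] E)‖ ^ m * R) atTop (𝓝 0) := by
    simpa using (tendsto_pow_atTop_nhds_zero_of_lt_one (norm_nonneg _) hA).mul_const R
  obtain ⟨N, hN⟩ := eventually_atTop.1 (hlim.eventually_lt_const hε)
  refine ⟨N, fun m x hx hmem => not_le.1 fun hle => hball ?_ hmem⟩
  rw [mem_ball_zero_iff]
  exact ((norm_pow_apply_le A m x).trans (by gcongr; exact hR x hx)).trans_lt (hN m hle)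

/-- Let `n ≥ 1` and `A` an invertible continuous linear automorphism of `ℂⁿ` with
operator norm `‖A‖ < 1`. Then the `ℤ`-action on `ℂⁿ \ {0}` given by `k • x = Aᵏ x`
is properly discontinuous: for any compact subsets `K, L` of `ℂⁿ \ {0}`, the set of
integers `k` with `Aᵏ(K) ∩ L ≠ ∅` is finite. -/
theorem hopf_action_properly_discontinuous (n : ℕ) (hn : 1 ≤ n)
    (A : EuclideanSpace ℂ (Fin n) ≃L[ℂ] EuclideanSpace ℂ (Fin n))
    (hA : ‖(A : EuclideanSpace ℂ (Fin n) →L[ℂ] EuclideanSpace ℂ (Fin n))‖ < 1)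
    (K L : Set (EuclideanSpace ℂ (Fin n)))
    (hK : IsCompact K) (hL : IsCompact L)
    (hK0 : (0 : EuclideanSpace ℂ (Fin n)) ∉ K)
    (hL0 : (0 : EuclideanSpace ℂ (Fin n)) ∉ L) :
    {k : ℤ | ((A ^ k) '' K ∩ L).Nonempty}.Finite := by
  obtain ⟨M, hM⟩ := exists_forall_pow_apply_mem_lt A hA hK.isBounded hL.isClosed hL0
  obtain ⟨N, hN⟩ := exists_forall_pow_apply_mem_lt A hA hL.isBounded hK.isClosed hK0
  refine (Set.finite_Icc (-(N : ℤ)) M).subset ?_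
  rintro k ⟨_, ⟨x, hx, rfl⟩, hy⟩
  obtain ⟨m, rfl | rfl⟩ := k.eq_nat_or_neg
  · have hm := hM m x hx (by simpa using hy)
    constructor <;> omega
  · have hinv : (A ^ m) ((A ^ (-(m : ℤ))) x) = x := by
      change (A ^ m * A ^ (-(m : ℤ))) x = x
      rw [zpow_neg, zpow_natCast, mul_inv_cancel]
      rfl
    have hm := hN m _ hy (hinv.symm ▸ hx)
    constructor <;> omega
end

section
/- Let n ≥ 1 and let A be an invertible continuous linear automorphism of ℂⁿ with operator norm ‖A‖ < 1, acting on ℂⁿ \ {0} by k • x = Aᵏ(x) for k ∈ ℤ. Then the quotient map from ℂⁿ \ {0} to the orbit space (ℂⁿ \ {0}) / ℤ is a covering map. -/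
/-- The orbit equivalence relation on `ℂⁿ \ {0}` of the `ℤ`-action generated by an
invertible continuous linear automorphism `A` of `ℂⁿ`, acting by `k • x = Aᵏ x`. -/
def hopfSetoid {n : ℕ}
    (A : EuclideanSpace ℂ (Fin n) ≃L[ℂ] EuclideanSpace ℂ (Fin n)) :
    Setoid {x : EuclideanSpace ℂ (Fin n) // x ≠ 0} where
  r x y := ∃ k : ℤ, (A ^ k) x.val = y.val
  iseqv := by
    constructor
    · intro x
      exact ⟨0, by rw [zpow_zero]; rfl⟩
    · rintro x y ⟨k, hk⟩
      refine ⟨-k, ?_⟩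
      have h1 : (A ^ (-k)) ((A ^ k) x.val) = ((A ^ (-k)) * (A ^ k)) x.val := rfl
      rw [← hk, h1, ← zpow_add, neg_add_cancel, zpow_zero]
      rfl
    · rintro x y z ⟨k, hk⟩ ⟨l, hl⟩
      refine ⟨l + k, ?_⟩
      have h1 : (A ^ l) ((A ^ k) x.val) = ((A ^ l) * (A ^ k)) x.val := rfl
      rw [← hl, ← hk, h1, ← zpow_add]

namespace ContinuousLinearEquiv

variable {𝕜 V : Type*} [NontriviallyNormedField 𝕜] [NormedAddCommGroup V] [NormedSpace 𝕜 V]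

lemma norm_pow_apply_le (A : V ≃L[𝕜] V) (k : ℕ) (x : V) :
    ‖(A ^ k) x‖ ≤ ‖(A : V →L[𝕜] V)‖ ^ k * ‖x‖ := by
  induction k with
  | zero => rw [pow_zero, pow_zero, one_mul]; rfl
  | succ k ih =>
    calc ‖(A ^ (k + 1)) x‖ = ‖(A : V →L[𝕜] V) ((A ^ k) x)‖ := by rw [pow_succ']; rfl
      _ ≤ ‖(A : V →L[𝕜] V)‖ * ‖(A ^ k) x‖ := (A : V →L[𝕜] V).le_opNorm _
      _ ≤ ‖(A : V →L[𝕜] V)‖ * (‖(A : V →L[𝕜] V)‖ ^ k * ‖x‖) := by gcongr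
      _ = ‖(A : V →L[𝕜] V)‖ ^ (k + 1) * ‖x‖ := by ring

lemma norm_zpow_apply_le_of_pos {A : V ≃L[𝕜] V} (hA : ‖(A : V →L[𝕜] V)‖ ≤ 1) {k : ℤ}
    (hk : 0 < k) (x : V) : ‖(A ^ k) x‖ ≤ ‖(A : V →L[𝕜] V)‖ * ‖x‖ := by
  lift k to ℕ using hk.le
  rw [zpow_natCast]
  refine (norm_pow_apply_le A k x).trans ?_
  gcongr
  exact pow_le_of_le_one (norm_nonneg _) hA (by omega)

/-- The action of `ℤ` on the nonzero vectors by the powers of a continuous linear automorphism. -/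
abbrev zpowAddAction (A : V ≃L[𝕜] V) : AddAction ℤ {x : V // x ≠ 0} where
  vadd k x := ⟨(A ^ k) x.val, (A ^ k).map_ne_zero_iff.mpr x.property⟩
  zero_vadd x := Subtype.ext <| show (A ^ (0 : ℤ)) x.val = x.val by rw [zpow_zero]; rfl
  add_vadd k l x := Subtype.ext <|
    show (A ^ (k + l)) x.val = (A ^ k) ((A ^ l) x.val) by rw [zpow_add]; rfl

/-- A nonzero vector has a neighborhood on which no element maps back into the neighborhood
under a nonzero power of a contracting automorphism. -/
lemma exists_nhds_forall_zpow_eq_zero {A : V ≃L[𝕜] V} (hA : ‖(A : V →L[𝕜] V)‖ < 1)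
    {x : V} (hx : x ≠ 0) :
    ∃ U ∈ nhds x, ∀ k : ℤ, ∀ y ∈ U, (A ^ k) y ∈ U → k = 0 := by
  obtain ⟨m, hm, hm'⟩ := exists_between (mul_lt_of_lt_one_left (norm_pos_iff.mpr hx) hA)
  refine ⟨{y | ‖(A : V →L[𝕜] V)‖ * ‖y‖ < m ∧ m < ‖y‖},
    ((isOpen_lt (continuous_const.mul continuous_norm) continuous_const).inter
      (isOpen_lt continuous_const continuous_norm)).mem_nhds ⟨hm, hm'⟩, ?_⟩
  rintro k y ⟨hy, hy'⟩ ⟨hz, hz'⟩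
  obtain hk | hk | hk := lt_trichotomy k 0
  · have h := norm_zpow_apply_le_of_pos hA.le (neg_pos.mpr hk) ((A ^ k) y)
    have hinv : (A ^ (-k)) ((A ^ k) y) = y := by
      change (A ^ (-k) * A ^ k) y = y
      rw [← zpow_add, neg_add_cancel, zpow_zero]
      rfl
    rw [hinv] at h
    linarith
  · exact hk
  · linarith [norm_zpow_apply_le_of_pos hA.le hk y]

end ContinuousLinearEquiv

/-- Let `n ≥ 1` and `A` an invertible continuous linear automorphism of `ℂⁿ` with
operator norm `‖A‖ < 1`, acting on `ℂⁿ \ {0}` by `k • x = Aᵏ x`. The quotient map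
from `ℂⁿ \ {0}` onto the orbit space (the linear Hopf manifold) is a covering map. -/
theorem hopf_quotient_isCoveringMap (n : ℕ) (hn : 1 ≤ n)
    (A : EuclideanSpace ℂ (Fin n) ≃L[ℂ] EuclideanSpace ℂ (Fin n))
    (hA : ‖(A : EuclideanSpace ℂ (Fin n) →L[ℂ] EuclideanSpace ℂ (Fin n))‖ < 1) :
    IsCoveringMap (Quotient.mk (hopfSetoid A) :
      {x : EuclideanSpace ℂ (Fin n) // x ≠ 0} → Quotient (hopfSetoid A)) := by
  let := A.zpowAddAction
  refine IsAddQuotientCoveringMap.isCoveringMap _ (G := ℤ)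
    { toIsQuotientMap := isQuotientMap_quotient_mk'
      continuous_const_vadd := fun k ↦
        ((A ^ k).continuous.comp continuous_subtype_val).subtype_mk _
      apply_eq_iff_mem_orbit := fun {x y} ↦ ?_
      disjoint := fun x ↦ ?_ }
  · rw [eq_comm, Quotient.eq]
    exact exists_congr fun k ↦ (Subtype.ext_iff (a1 := k +ᵥ y) (a2 := x)).symm
  · obtain ⟨U, hU, hUA⟩ :=
      ContinuousLinearEquiv.exists_nhds_forall_zpow_eq_zero hA x.property
    refine ⟨Subtype.val ⁻¹' U, continuous_subtype_val.continuousAt.preimage_mem_nhds hU, ?_⟩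
    rintro k ⟨_, ⟨y, hy, rfl⟩, hky⟩
    exact hUA k y.val hy hky
end
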